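/- Fix L, T, σ > 0, constants c_B, c_L, c_∞ ∈ (0,∞), and a nonempty compact set U ⊆ ℝ. Let b, f : [0,T] × [0,L] × U → ℝ be continuous with |b| ≤ c_B, |f| ≤ c_∞, |b(t,x,u) − b(t,x',u)| ≤ c_L|x−x'| and |f(t,x,u) − f(t,x',u)| ≤ c_L|x−x'| for all t, x, x', u; let g : [0,L] → ℝ satisfy |g(x) − g(x')| ≤ c_L|x−x'|; and let y, r : [0,T] → ℝ satisfy |y| ≤ c_∞, |r| ≤ c_∞. Let h ∈ (0, σ²/c_B) be such that L/h is a positive integer and, with Δ := h²/σ², T/Δ is a positive integer. On the grids 𝕊 = {0, h, 2h, …, L} and 𝕋 = {0, Δ, 2Δ, …, T}, define V : 𝕋 × 𝕊 → ℝ by backward recursion: V(T, x) = g(x), and for t ∈ 𝕋 with t < T and x ∈ 𝕊, V(t, x) = inf_{u ∈ U} [ Δ f(t,x,u) + q⁺(t,x,u) Ṽ(t+Δ, x+h) + q⁻(t,x,u) Ṽ(t+Δ, x−h) ], where q±(t,x,u) = (±h b(t,x,u) + σ²)/(2σ²), Ṽ(s, x) = V(s, x) for x ∈ 𝕊, Ṽ(s,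 −h) = y(s) h + V(s, 0), and Ṽ(s, L+h) = r(s) h + V(s, L). Then there exists a constant c̄ ∈ (0,∞), depending only on L, T, σ, c_B, c_L, c_∞ (in particular independent of h and of the particular functions b, f, g, y, r satisfying the above bounds), such that |V(t, x) − V(t, x')| ≤ c̄ |x − x'| for all t ∈ 𝕋 and x, x' ∈ 𝕊. -/

import Mathlib

/-- The boundary extension `Ṽ` of a grid function `V`: `Ṽ(s,x) = V(s,x)` for
`x ∈ [0,L]`, `Ṽ(s,x) = y(s)h + V(s,0)` for `x < 0` (in particular `x = −h`),
and `Ṽ(s,x) = r(s)h + V(s,L)` for `x > L` (in particular `x = L+h`). -/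
noncomputable def Vtilde (L h : ℝ) (y r : ℝ → ℝ) (V : ℝ → ℝ → ℝ) (s x : ℝ) : ℝ :=
  if x < 0 then y s * h + V s 0 else if L < x then r s * h + V s L else V s x

lemma aux_iInf_le {ι : Type*} [Nonempty ι] (F G : ι → ℝ) (K : ℝ)
    (h : ∀ u, |F u - G u| ≤ K) : |(⨅ u, F u) - ⨅ u, G u| ≤ K := by
  obtain ⟨u0⟩ := ‹Nonempty ι›
  have hK : 0 ≤ K := (abs_nonneg _).trans (h u0)
  have : Nonempty ι := ⟨u0⟩
  have key : ∀ (F G : ι → ℝ), (∀ u, |F u - G u| ≤ K) → BddBelow (Set.range F) →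
      BddBelow (Set.range G) := by
    rintro F G h ⟨c, hc⟩
    refine ⟨c - K, ?_⟩
    rintro _ ⟨u, rfl⟩
    have h1 := hc ⟨u, rfl⟩
    have h2 := (abs_le.1 (h u)).2
    linarith
  have key2 : ∀ (F G : ι → ℝ), (∀ u, |F u - G u| ≤ K) → BddBelow (Set.range F) →
      (⨅ u, F u) - K ≤ ⨅ u, G u := by
    intro F G h hF
    refine le_ciInf fun u => ?_
    have h1 := ciInf_le hF u
    have h2 := (abs_le.1 (h u)).2
    linarith
  have h' : ∀ u, |G u - F u| ≤ K := fun u => by rw [abs_sub_comm]; exact h u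
  by_cases hF : BddBelow (Set.range F)
  · have hG := key F G h hF
    have h1 := key2 F G h hF
    have h2 := key2 G F h' hG
    rw [abs_le]; constructor <;> linarith
  · have hG : ¬ BddBelow (Set.range G) := fun hG => hF (key G F h' hG)
    rw [Real.iInf_of_not_bddBelow hF, Real.iInf_of_not_bddBelow hG]
    simpa using hK

lemma aux_step (Δ h s b b' f f' c A B C E M : ℝ) (hs : 0 < s) (hh : 0 < h)
    (hΔ : Δ = h ^ 2 / s) (hM : 0 ≤ M)
    (hb : |h * b| ≤ s) (hb' : |h * b'| ≤ s)
    (hbb : |b' - b| ≤ c * h) (hff : |f' - f| ≤ c * h)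
    (h1 : |E - C| ≤ M) (h2 : |C - B| ≤ M) (h3 : |B - A| ≤ M) :
    |(Δ * f' + ((h * b' + s) / (2 * s)) * E + ((-(h * b') + s) / (2 * s)) * B)
      - (Δ * f + ((h * b + s) / (2 * s)) * C + ((-(h * b) + s) / (2 * s)) * A)|
      ≤ Δ * (c * h) + (1 + c * Δ) * M := by
  have hΔ0 : 0 ≤ Δ := by rw [hΔ]; positivity
  have e : (Δ * f' + ((h * b' + s) / (2 * s)) * E + ((-(h * b') + s) / (2 * s)) * B)
      - (Δ * f + ((h * b + s) / (2 * s)) * C + ((-(h * b) + s) / (2 * s)) * A)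
      = Δ * (f' - f) + ((h * b' + s) / (2 * s)) * (E - C)
        + (h * (b' - b) / (2 * s)) * (C - B) + ((-(h * b) + s) / (2 * s)) * (B - A) := by
    field_simp
    ring
  rw [e]
  have p1 : 0 ≤ (h * b' + s) / (2 * s) := by
    have := (abs_le.1 hb').1
    apply div_nonneg <;> linarith
  have p2 : 0 ≤ (-(h * b) + s) / (2 * s) := by
    have := (abs_le.1 hb).2
    apply div_nonneg <;> linarith
  have hd : |h * (b' - b) / (2 * s)| ≤ c * Δ / 2 := by
    rw [abs_div, abs_mul, abs_of_pos hh, abs_of_pos (by linarith : 0 < 2 * s), hΔ]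
    have : h * |b' - b| ≤ h * (c * h) := by gcongr
    calc h * |b' - b| / (2 * s) ≤ h * (c * h) / (2 * s) := by gcongr
      _ = _ := by field_simp
  have t1 : |Δ * (f' - f)| ≤ Δ * (c * h) := by
    rw [abs_mul, abs_of_nonneg hΔ0]; gcongr
  have t2 : |((h * b' + s) / (2 * s)) * (E - C)| ≤ ((h * b' + s) / (2 * s)) * M := by
    rw [abs_mul, abs_of_nonneg p1]; gcongr
  have t3 : |(h * (b' - b) / (2 * s)) * (C - B)| ≤ c * Δ / 2 * M := by
    rw [abs_mul]; gcongr
    exact (abs_nonneg _).trans hd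
  have t4 : |((-(h * b) + s) / (2 * s)) * (B - A)| ≤ ((-(h * b) + s) / (2 * s)) * M := by
    rw [abs_mul, abs_of_nonneg p2]; gcongr
  have t5 : ((h * b' + s) / (2 * s)) * M + ((-(h * b) + s) / (2 * s)) * M
      ≤ (1 + c * Δ / 2) * M := by
    rw [← add_mul]
    refine mul_le_mul_of_nonneg_right ?_ hM
    have : (h * b' + s) / (2 * s) + (-(h * b) + s) / (2 * s) = 1 + h * (b' - b) / (2 * s) := by
      field_simp; ring
    rw [this]
    linarith [(abs_le.1 hd).2]
  have a1 := abs_add_le (Δ * (f' - f) + ((h * b' + s) / (2 * s)) * (E - C)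
        + (h * (b' - b) / (2 * s)) * (C - B)) (((-(h * b) + s) / (2 * s)) * (B - A))
  have a2 := abs_add_le (Δ * (f' - f) + ((h * b' + s) / (2 * s)) * (E - C))
        ((h * (b' - b) / (2 * s)) * (C - B))
  have a3 := abs_add_le (Δ * (f' - f)) (((h * b' + s) / (2 * s)) * (E - C))
  linarith

lemma aux_grid (V : ℝ → ℝ) (h K : ℝ) (hh : 0 < h) (m : ℕ)
    (H : ∀ i : ℕ, i < m → |V (((i : ℝ) + 1) * h) - V ((i : ℝ) * h)| ≤ K * h)
    (i i' : ℕ) (hi : i ≤ m) (hi' : i' ≤ m) :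
    |V ((i : ℝ) * h) - V ((i' : ℝ) * h)| ≤ K * |(i : ℝ) * h - (i' : ℝ) * h| := by
  have key : ∀ k i : ℕ, i + k ≤ m →
      |V (((i + k : ℕ) : ℝ) * h) - V ((i : ℝ) * h)| ≤ K * (k * h) := by
    intro k i
    induction k with
    | zero => intro _; simp
    | succ k ih =>
      intro hk
      have h1 := ih (by omega)
      have h2 := H (i + k) (by omega)
      have e : (((i + k : ℕ) : ℝ) + 1) = ((i + (k + 1) : ℕ) : ℝ) := by push_cast; ring
      rw [e] at h2
      have h3 := abs_sub_le (V (((i + (k + 1) : ℕ) : ℝ) * h)) (V (((i + k : ℕ) : ℝ) * h))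
        (V ((i : ℝ) * h))
      push_cast at *
      linarith
  rcases le_total i i' with hle | hle
  · obtain ⟨k, rfl⟩ := Nat.exists_eq_add_of_le hle
    have := key k i hi'
    rw [abs_sub_comm, abs_sub_comm ((i : ℝ) * h)]
    refine this.trans (le_of_eq ?_)
    have : (((i + k : ℕ) : ℝ) * h - i * h) = k * h := by push_cast; ring
    rw [this, abs_of_nonneg (by positivity)]
  · obtain ⟨k, rfl⟩ := Nat.exists_eq_add_of_le hle
    have := key k i' hi
    refine this.trans (le_of_eq ?_)
    have : (((i' + k : ℕ) : ℝ) * h - i' * h) = k * h := by push_cast; ring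
    rw [this, abs_of_nonneg (by positivity)]

lemma aux_tilde_mid (L h : ℝ) (y r : ℝ → ℝ) (V : ℝ → ℝ → ℝ) (s : ℝ) (hh : 0 < h) (m : ℕ)
    (hL : L = m * h) (i : ℕ) (hi : i ≤ m) :
    Vtilde L h y r V s ((i : ℝ) * h) = V s ((i : ℝ) * h) := by
  have h0 : 0 ≤ (i : ℝ) * h := by positivity
  have h1 : (i : ℝ) * h ≤ L := by
    rw [hL]; gcongr
  simp [Vtilde, not_lt.2 h0, not_lt.2 h1]

lemma aux_tilde_up (L h : ℝ) (y r : ℝ → ℝ) (V : ℝ → ℝ → ℝ) (s M : ℝ) (hh : 0 < h) (m : ℕ)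
    (hL : L = m * h) (hr : |r s * h| ≤ M)
    (H : ∀ i : ℕ, i < m → |V s (((i : ℝ) + 1) * h) - V s ((i : ℝ) * h)| ≤ M)
    (i : ℕ) (hi : i ≤ m) :
    |Vtilde L h y r V s ((i : ℝ) * h + h) - V s ((i : ℝ) * h)| ≤ M := by
  rcases hi.lt_or_eq with hlt | rfl
  · have e : (i : ℝ) * h + h = ((i + 1 : ℕ) : ℝ) * h := by push_cast; ring
    rw [e, aux_tilde_mid L h y r V s hh m hL (i + 1) hlt]
    have := H i hlt
    push_cast
    exact this
  · have h0 : 0 ≤ (i : ℝ) * h + h := by positivity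
    have h1 : L < (i : ℝ) * h + h := by linarith
    have : Vtilde L h y r V s ((i : ℝ) * h + h) = r s * h + V s L := by
      simp [Vtilde, not_lt.2 h0, h1]
    rw [this, hL]
    simpa using hr

lemma aux_tilde_down (L h : ℝ) (y r : ℝ → ℝ) (V : ℝ → ℝ → ℝ) (s M : ℝ) (hh : 0 < h) (m : ℕ)
    (hL : L = m * h) (hy : |y s * h| ≤ M)
    (H : ∀ i : ℕ, i < m → |V s (((i : ℝ) + 1) * h) - V s ((i : ℝ) * h)| ≤ M)
    (i : ℕ) (hi : i ≤ m) :
    |V s ((i : ℝ) * h) - Vtilde L h y r V s ((i : ℝ) * h - h)| ≤ M := by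
  cases i with
  | zero =>
    have : Vtilde L h y r V s (((0 : ℕ) : ℝ) * h - h) = y s * h + V s 0 := by
      simp [Vtilde, hh]
    rw [this]
    simpa using hy
  | succ i =>
    have e : ((i + 1 : ℕ) : ℝ) * h - h = (i : ℝ) * h := by push_cast; ring
    rw [e, aux_tilde_mid L h y r V s hh m hL i (by omega)]
    have := H i (by omega)
    push_cast
    exact this

/-- Uniform-in-`h` Lipschitz bound for the discrete value function of the
Markov chain approximation scheme: if `V` satisfies the backward dynamic
programming recursion on the grids `𝕊 = {0, h, …, L}`, `𝕋 = {0, Δ, …, T}`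
(`Δ = h²/σ²`) with data `b, f, g, y, r` satisfying the stated bounds and
Lipschitz properties, then `|V(t,x) − V(t,x')| ≤ c̄ |x − x'|` on the grid for
a constant `c̄` depending only on `L, T, σ, c_B, c_L, c_∞` (in particular
independent of `h` and of the particular functions `b, f, g, y, r`). -/
theorem discrete_value_function_lipschitz
    (L T σ c_B c_L c_inf : ℝ)
    (hL : 0 < L) (hT : 0 < T) (hσ : 0 < σ)
    (hcB : 0 < c_B) (hcL : 0 < c_L) (hcinf : 0 < c_inf)
    (U : Set ℝ) (hUc : IsCompact U) (hUne : U.Nonempty) :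
    ∃ cbar : ℝ, 0 < cbar ∧
      ∀ h : ℝ, 0 < h → h < σ ^ 2 / c_B →
      ∀ m n : ℕ, 0 < m → 0 < n → L = (m : ℝ) * h → T = (n : ℝ) * (h ^ 2 / σ ^ 2) →
      ∀ (b f : ℝ → ℝ → ℝ → ℝ) (g y r : ℝ → ℝ) (V : ℝ → ℝ → ℝ),
        ContinuousOn (fun q : ℝ × ℝ × ℝ => b q.1 q.2.1 q.2.2)
          (Set.Icc 0 T ×ˢ Set.Icc 0 L ×ˢ U) →
        ContinuousOn (fun q : ℝ × ℝ × ℝ => f q.1 q.2.1 q.2.2)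
          (Set.Icc 0 T ×ˢ Set.Icc 0 L ×ˢ U) →
        (∀ t ∈ Set.Icc (0 : ℝ) T, ∀ x ∈ Set.Icc (0 : ℝ) L, ∀ u ∈ U, |b t x u| ≤ c_B) →
        (∀ t ∈ Set.Icc (0 : ℝ) T, ∀ x ∈ Set.Icc (0 : ℝ) L, ∀ u ∈ U, |f t x u| ≤ c_inf) →
        (∀ t ∈ Set.Icc (0 : ℝ) T, ∀ x ∈ Set.Icc (0 : ℝ) L, ∀ x' ∈ Set.Icc (0 : ℝ) L,
          ∀ u ∈ U, |b t x u - b t x' u| ≤ c_L * |x - x'|) →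
        (∀ t ∈ Set.Icc (0 : ℝ) T, ∀ x ∈ Set.Icc (0 : ℝ) L, ∀ x' ∈ Set.Icc (0 : ℝ) L,
          ∀ u ∈ U, |f t x u - f t x' u| ≤ c_L * |x - x'|) →
        (∀ x ∈ Set.Icc (0 : ℝ) L, ∀ x' ∈ Set.Icc (0 : ℝ) L, |g x - g x'| ≤ c_L * |x - x'|) →
        (∀ t ∈ Set.Icc (0 : ℝ) T, |y t| ≤ c_inf) →
        (∀ t ∈ Set.Icc (0 : ℝ) T, |r t| ≤ c_inf) →
        (∀ i : ℕ, i ≤ m → V T ((i : ℝ) * h) = g ((i : ℝ) * h)) →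
        (∀ j : ℕ, j < n → ∀ i : ℕ, i ≤ m →
          V ((j : ℝ) * (h ^ 2 / σ ^ 2)) ((i : ℝ) * h) =
            ⨅ u : U, ((h ^ 2 / σ ^ 2) * f ((j : ℝ) * (h ^ 2 / σ ^ 2)) ((i : ℝ) * h) u
              + ((h * b ((j : ℝ) * (h ^ 2 / σ ^ 2)) ((i : ℝ) * h) u + σ ^ 2) / (2 * σ ^ 2))
                  * Vtilde L h y r V (((j : ℝ) + 1) * (h ^ 2 / σ ^ 2)) ((i : ℝ) * h + h)
              + ((-(h * b ((j : ℝ) * (h ^ 2 / σ ^ 2)) ((i : ℝ) * h) u) + σ ^ 2) / (2 * σ ^ 2))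
                  * Vtilde L h y r V (((j : ℝ) + 1) * (h ^ 2 / σ ^ 2)) ((i : ℝ) * h - h))) →
        ∀ j : ℕ, j ≤ n → ∀ i : ℕ, i ≤ m → ∀ i' : ℕ, i' ≤ m →
          |V ((j : ℝ) * (h ^ 2 / σ ^ 2)) ((i : ℝ) * h)
              - V ((j : ℝ) * (h ^ 2 / σ ^ 2)) ((i' : ℝ) * h)|
            ≤ cbar * |(i : ℝ) * h - (i' : ℝ) * h| := by
  refine ⟨(1 + c_L + c_inf) * Real.exp (c_L * T), by positivity, ?_⟩
  intro h hh hhB m n hm hn hLm hTn b f g y r V _ _ hb _ hbL hfL hg hy hr hVT hV j hj i hi i' hi'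
  have : Nonempty U := hUne.to_subtype
  obtain ⟨Δ, hΔ⟩ : ∃ Δ : ℝ, Δ = h ^ 2 / σ ^ 2 := ⟨_, rfl⟩
  rw [← hΔ] at hTn hV ⊢
  have hΔ0 : 0 < Δ := by rw [hΔ]; positivity
  have hs : 0 < σ ^ 2 := by positivity
  have hhB' : h * c_B ≤ σ ^ 2 := ((lt_div_iff₀ hcB).1 hhB).le
  have hgrid : ∀ i : ℕ, i ≤ m → (i : ℝ) * h ∈ Set.Icc (0 : ℝ) L := by
    intro i hi
    refine ⟨by positivity, ?_⟩
    rw [hLm]; gcongr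
  have htime : ∀ j : ℕ, j ≤ n → (j : ℝ) * Δ ∈ Set.Icc (0 : ℝ) T := by
    intro i hi
    refine ⟨by positivity, ?_⟩
    rw [hTn]; gcongr
  have hbh : ∀ t ∈ Set.Icc (0 : ℝ) T, ∀ x ∈ Set.Icc (0 : ℝ) L, ∀ u ∈ U,
      |h * b t x u| ≤ σ ^ 2 := by
    intro t ht x hx u hu
    rw [abs_mul, abs_of_pos hh]
    exact (mul_le_mul_of_nonneg_left (hb t ht x hx u hu) hh.le).trans hhB'
  have hdiff : ∀ i : ℕ, |((i : ℝ) + 1) * h - (i : ℝ) * h| = h := by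
    intro i
    rw [show ((i : ℝ) + 1) * h - (i : ℝ) * h = h by ring, abs_of_pos hh]
  have hpow1 : ∀ k : ℕ, 1 ≤ (1 + c_L * Δ) ^ k := fun k =>
    one_le_pow₀ (by nlinarith [mul_pos hcL hΔ0])
  have main : ∀ k : ℕ, ∀ j : ℕ, j + k = n → ∀ i : ℕ, i < m →
      |V ((j : ℝ) * Δ) (((i : ℝ) + 1) * h) - V ((j : ℝ) * Δ) ((i : ℝ) * h)|
        ≤ ((1 + c_L + c_inf) * (1 + c_L * Δ) ^ k - 1) * h := by
    intro k
    induction k with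
    | zero =>
      intro j hj i hi
      obtain rfl : j = n := by omega
      have h1 := hVT i hi.le
      have h2 := hVT (i + 1) hi
      have g1 := hgrid i hi.le
      have g2 := hgrid (i + 1) hi
      push_cast at h2 g2
      rw [← hTn, h1, h2]
      have h3 := hg _ g2 _ g1
      rw [hdiff] at h3
      refine h3.trans ?_
      gcongr
      simp only [pow_zero]
      linarith
    | succ k ih =>
      intro j hj i hi
      have H := ih (j + 1) (by omega)
      have htj := htime j (by omega)
      have htj1 := htime (j + 1) (by omega)
      push_cast at H htj1
      set s : ℝ := ((j : ℝ) + 1) * Δ with hsdef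
      set M : ℝ := ((1 + c_L + c_inf) * (1 + c_L * Δ) ^ k - 1) * h with hMdef
      have hMc : c_inf * h ≤ M := by
        rw [hMdef]
        gcongr
        nlinarith [hpow1 k]
      have hM0 : 0 ≤ M := le_trans (by positivity) hMc
      have hys : |y s * h| ≤ M := by
        rw [abs_mul, abs_of_pos hh]
        exact (mul_le_mul_of_nonneg_right (hy s htj1) hh.le).trans hMc
      have hrs : |r s * h| ≤ M := by
        rw [abs_mul, abs_of_pos hh]
        exact (mul_le_mul_of_nonneg_right (hr s htj1) hh.le).trans hMc
      have v1 := hV j (by omega) i hi.le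
      have v2 := hV j (by omega) (i + 1) hi
      have g1 := hgrid i hi.le
      have g2 := hgrid (i + 1) hi
      have u1 := aux_tilde_up L h y r V s M hh m hLm hrs H (i + 1) hi
      have u2 := H i hi
      have u3 := aux_tilde_down L h y r V s M hh m hLm hys H i hi.le
      have mid1 := aux_tilde_mid L h y r V s hh m hLm i hi.le
      have mid2 := aux_tilde_mid L h y r V s hh m hLm (i + 1) hi
      push_cast at v2 g2 u1 mid2
      rw [show ((i : ℝ) + 1) * h - h = (i : ℝ) * h by ring, mid1] at v2
      rw [show (i : ℝ) * h + h = ((i : ℝ) + 1) * h by ring, mid2] at v1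
      rw [v1, v2]
      have : ((1 + c_L + c_inf) * (1 + c_L * Δ) ^ (k + 1) - 1) * h
          = Δ * (c_L * h) + (1 + c_L * Δ) * M := by
        rw [hMdef]; ring
      rw [this]
      apply aux_iInf_le
      rintro ⟨u, hu⟩
      have q1 := hbL _ htj _ g2 _ g1 u hu
      have q2 := hfL _ htj _ g2 _ g1 u hu
      rw [hdiff] at q1 q2
      exact aux_step Δ h (σ ^ 2) _ _ _ _ c_L _ _ _ _ M hs hh hΔ hM0
        (hbh _ htj _ g1 u hu) (hbh _ htj _ g2 u hu) q1 q2 u1 u2 u3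
  refine aux_grid (V ((j : ℝ) * Δ)) h _ hh m ?_ i i' hi hi'
  intro i hi
  refine (main (n - j) j (by omega) i hi).trans ?_
  gcongr
  have e1 : (1 + c_L * Δ) ^ (n - j) ≤ Real.exp (c_L * T) := by
    calc (1 + c_L * Δ) ^ (n - j) ≤ (1 + c_L * Δ) ^ n :=
          pow_le_pow_right₀ (by nlinarith [mul_pos hcL hΔ0]) (Nat.sub_le _ _)
      _ ≤ (Real.exp (c_L * Δ)) ^ n := by
          gcongr
          linarith [Real.add_one_le_exp (c_L * Δ)]
      _ = Real.exp (c_L * T) := by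
          rw [← Real.exp_nat_mul, hTn]; congr 1; ring
  have e2 : (1 + c_L + c_inf) * (1 + c_L * Δ) ^ (n - j)
      ≤ (1 + c_L + c_inf) * Real.exp (c_L * T) := by gcongr
  linarith
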